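/- Let X be an infinite-dimensional Banach space and let (y_n) be a sequence in X* with ‖y_n‖ = 1 for all n and y_n(x) → 0 as n → ∞ for every x ∈ X (such a sequence exists by the Josefson–Nissenzweig theorem). Then there exist a subsequence (y_{n_k}) of (y_n) and a sequence (x_{n_k}) in X with ‖x_{n_k}‖ = 1 for all k, such that |y_{n_k}(x_{n_k})| ≥ 1/2 for all k and k²|y_{n_k}(x_{n_l})| → 0 as k → ∞ for every fixed l; consequently, the sequence (k·y_{n_k}) is norm unbounded but pointwise bounded on the linear span of {x_{n_k}}. -/

import Mathlib

open Filter Topology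

/-- A functional of norm greater than `r ≥ 0` exceeds `r` in absolute value at some unit vector. -/
theorem exists_norm_eq_one_lt_abs_apply {X : Type*} [NormedAddCommGroup X] [NormedSpace ℝ X]
    (f : X →L[ℝ] ℝ) {r : ℝ} (hr : 0 ≤ r) (hf : r < ‖f‖) :
    ∃ x : X, ‖x‖ = 1 ∧ r < |f x| := by
  obtain ⟨x, hx, hfx⟩ := f.exists_lt_apply_of_lt_opNorm hf
  rw [Real.norm_eq_abs] at hfx
  have hx0 : x ≠ 0 := by
    rintro rfl
    simp only [map_zero, abs_zero] at hfx
    linarith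
  have hpos : 0 < ‖x‖ := norm_pos_iff.mpr hx0
  refine ⟨‖x‖⁻¹ • x, ?_, hfx.trans_le ?_⟩
  · rw [norm_smul, norm_inv, norm_norm, inv_mul_cancel₀ hpos.ne']
  · rw [map_smul, smul_eq_mul, abs_mul, abs_of_pos (inv_pos.mpr hpos)]
    exact le_mul_of_one_le_left (abs_nonneg _) ((one_le_inv₀ hpos).mpr hx.le)

/-- If every column of a real matrix tends to zero, then along some subsequence of indices the
entries below the diagonal are dominated by any prescribed positive sequence. -/
theorem exists_strictMono_abs_le_of_tendsto_zero {a : ℕ → ℕ → ℝ}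
    (ha : ∀ i, Tendsto (fun n => a n i) atTop (𝓝 0)) {ε : ℕ → ℝ} (hε : ∀ k, 0 < ε k) :
    ∃ φ : ℕ → ℕ, StrictMono φ ∧ ∀ k l, l < k → |a (φ k) (φ l)| ≤ ε k := by
  have hstep : ∀ k N : ℕ, ∃ n, N < n ∧ ∀ i ≤ N, |a n i| ≤ ε k := by
    intro k N
    have hev : ∀ᶠ n in atTop, ∀ i ∈ Set.Iic N, |a n i| ≤ ε k :=
      (Set.finite_Iic N).eventually_all.mpr fun i _ =>
        ((ha i).abs.eventually_le_const (by simpa using hε k))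
    exact ((eventually_gt_atTop N).and hev).exists
  choose g hg_lt hg_le using hstep
  let φ : ℕ → ℕ := fun k => Nat.rec 0 (fun j p => g (j + 1) p) k
  have hφ : StrictMono φ := strictMono_nat_of_lt_succ fun k => hg_lt (k + 1) (φ k)
  refine ⟨φ, hφ, fun k l hlk => ?_⟩
  obtain ⟨j, rfl⟩ := Nat.exists_eq_succ_of_ne_zero (Nat.ne_zero_of_lt hlk)
  exact hg_le (j + 1) (φ j) (φ l) (hφ.monotone (Nat.lt_succ_iff.mp hlk))

/-- A family of linear functionals that is pointwise bounded on a set is pointwise bounded on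
its span. -/
theorem exists_abs_apply_le_of_mem_span {X ι : Type*} [NormedAddCommGroup X] [NormedSpace ℝ X]
    {f : ι → X →L[ℝ] ℝ} {s : Set X} (hs : ∀ x ∈ s, ∃ C : ℝ, ∀ k, |f k x| ≤ C)
    {x : X} (hx : x ∈ Submodule.span ℝ s) : ∃ C : ℝ, ∀ k, |f k x| ≤ C := by
  induction hx using Submodule.span_induction with
  | mem x hx => exact hs x hx
  | zero => exact ⟨0, fun k => by simp⟩
  | add x z _ _ ihx ihz =>
    obtain ⟨C, hC⟩ := ihx
    obtain ⟨D, hD⟩ := ihz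
    refine ⟨C + D, fun k => ?_⟩
    rw [map_add]
    exact (abs_add_le _ _).trans (add_le_add (hC k) (hD k))
  | smul c x _ ih =>
    obtain ⟨C, hC⟩ := ih
    refine ⟨|c| * C, fun k => ?_⟩
    rw [map_smul, smul_eq_mul, abs_mul]
    exact mul_le_mul_of_nonneg_left (hC k) (abs_nonneg c)

theorem josefson_nissenzweig_detecting (X : Type*) [NormedAddCommGroup X]
    [NormedSpace ℝ X] [CompleteSpace X] (hdim : ¬ FiniteDimensional ℝ X)
    (y : ℕ → (X →L[ℝ] ℝ)) (hnorm : ∀ n, ‖y n‖ = 1)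
    (hw : ∀ x : X, Tendsto (fun n => y n x) atTop (𝓝 0)) :
    ∃ φ : ℕ → ℕ, StrictMono φ ∧
      ∃ xs : ℕ → X, (∀ k, ‖xs k‖ = 1) ∧
        (∀ k, (1 : ℝ) / 2 ≤ |y (φ k) (xs k)|) ∧
        (∀ l, Tendsto (fun k : ℕ => (k : ℝ) ^ 2 * |y (φ k) (xs l)|) atTop (𝓝 0)) ∧
        (¬ ∃ C : ℝ, ∀ k : ℕ, ‖(k : ℝ) • y (φ k)‖ ≤ C) ∧
        (∀ x ∈ Submodule.span ℝ (Set.range xs),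
          ∃ C : ℝ, ∀ k : ℕ, |((k : ℝ) • y (φ k)) x| ≤ C) := by
  choose u hu_norm hu_lt using fun n =>
    exists_norm_eq_one_lt_abs_apply (y n) (r := 1 / 2) (by norm_num) (by rw [hnorm]; norm_num)
  obtain ⟨φ, hφ, hφ_le⟩ := exists_strictMono_abs_le_of_tendsto_zero
    (a := fun n i => y n (u i)) (fun i => hw (u i))
    (ε := fun k => 1 / ((k : ℝ) + 1) ^ 3) (fun k => by positivity)
  have hlim : ∀ l, Tendsto (fun k : ℕ => (k : ℝ) ^ 2 * |y (φ k) (u (φ l))|) atTop (𝓝 0) := by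
    intro l
    refine squeeze_zero' (Eventually.of_forall fun k => by positivity) ?_
      (tendsto_one_div_add_atTop_nhds_zero_nat (𝕜 := ℝ))
    filter_upwards [eventually_gt_atTop l] with k hk
    calc (k : ℝ) ^ 2 * |y (φ k) (u (φ l))|
        ≤ ((k : ℝ) + 1) ^ 2 * (1 / ((k : ℝ) + 1) ^ 3) := by
          gcongr
          · linarith
          · exact hφ_le k l hk
      _ = 1 / ((k : ℝ) + 1) := by field_simp
  refine ⟨φ, hφ, fun k => u (φ k), fun k => hu_norm _, fun k => (hu_lt _).le, hlim, ?_, ?_⟩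
  · rintro ⟨C, hC⟩
    obtain ⟨k, hk⟩ := exists_nat_gt C
    have hCk := hC k
    rw [norm_smul, hnorm, mul_one, Real.norm_natCast] at hCk
    linarith
  · refine fun x hx => exists_abs_apply_le_of_mem_span ?_ hx
    rintro _ ⟨l, rfl⟩
    obtain ⟨C, hC⟩ := (hlim l).bddAbove_range
    refine ⟨C, fun k => le_trans ?_ (hC ⟨k, rfl⟩)⟩
    rw [smul_apply, smul_eq_mul, abs_mul, Nat.abs_cast]
    refine mul_le_mul_of_nonneg_right ?_ (abs_nonneg _)
    exact_mod_cast Nat.le_self_pow two_ne_zero k
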